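/- arXiv:1709.08701 — 2 statements merged into one kernel-verified Lean document; each statement's English description precedes it below -/
import Mathlib

section
/- Let I = I(C_{2n+1}) be the edge ideal of the odd cycle C_{2n+1}. Then for all s, t ≥ 1, α(I^(t)) < α(I^s) if and only if I^(t) ⊄ I^s. -/
open MvPolynomial

noncomputable section

/-- The ideal generated by the variables indexed by `S`. -/
def varIdeal (K : Type*) [Field K] (N : ℕ) (S : Finset (Fin N)) :
    Ideal (MvPolynomial (Fin N) K) :=
  Ideal.span ((fun i => (X i : MvPolynomial (Fin N) K)) '' S)

/-- The edge ideal of a graph `G`, generated by `X i * X j` for edges `{i, j}`. -/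
def edgeIdeal (K : Type*) [Field K] {N : ℕ} (G : SimpleGraph (Fin N)) :
    Ideal (MvPolynomial (Fin N) K) :=
  Ideal.span {p | ∃ i j, G.Adj i j ∧ p = X i * X j}

/-- `S` is a vertex cover of `G`: every edge meets `S`. -/
def IsVertexCover {N : ℕ} (G : SimpleGraph (Fin N)) (S : Finset (Fin N)) : Prop :=
  ∀ ⦃i j : Fin N⦄, G.Adj i j → i ∈ S ∨ j ∈ S

/-- `S` is a minimal vertex cover of `G`. -/
def IsMinVertexCover {N : ℕ} (G : SimpleGraph (Fin N)) (S : Finset (Fin N)) : Prop :=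
  IsVertexCover G S ∧ ∀ T ⊂ S, ¬ IsVertexCover G T

/-- The `t`-th symbolic power of the edge ideal of `G`:
the intersection of the `t`-th powers of the minimal vertex cover primes. -/
def symbolicPower (K : Type*) [Field K] {N : ℕ} (G : SimpleGraph (Fin N)) (t : ℕ) :
    Ideal (MvPolynomial (Fin N) K) :=
  ⨅ (S : Finset (Fin N)) (_ : IsMinVertexCover G S), varIdeal K N S ^ t

/-- The cycle graph on `Fin m`, with edges `{i, i+1 mod m}`. -/
def cycleGraph (m : ℕ) : SimpleGraph (Fin m) :=
  SimpleGraph.fromRel (fun i j => (j : ℕ) = ((i : ℕ) + 1) % m)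

/-- The set `L(t)` of monomials of degree at least `2t` whose weight with respect to every
minimal vertex cover is at least `t`. -/
def Lset (K : Type*) [Field K] {N : ℕ} (G : SimpleGraph (Fin N)) (t : ℕ) :
    Set (MvPolynomial (Fin N) K) :=
  {p | ∃ a : Fin N →₀ ℕ, p = monomial a 1 ∧ 2 * t ≤ ∑ i, a i ∧
    ∀ S : Finset (Fin N), IsMinVertexCover G S → t ≤ ∑ i ∈ S, a i}

/-- The set `D(t)` of monomials of degree less than `2t` whose weight with respect to every
minimal vertex cover is at least `t`. -/
def Dset (K : Type*) [Field K] {N : ℕ} (G : SimpleGraph (Fin N)) (t : ℕ) :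
    Set (MvPolynomial (Fin N) K) :=
  {p | ∃ a : Fin N →₀ ℕ, p = monomial a 1 ∧ (∑ i, a i) < 2 * t ∧
    ∀ S : Finset (Fin N), IsMinVertexCover G S → t ≤ ∑ i ∈ S, a i}

/-- `α(J)`: the least total degree of a nonzero polynomial in `J`. -/
def alphaDeg {K : Type*} [Field K] {N : ℕ} (J : Ideal (MvPolynomial (Fin N) K)) : ℕ :=
  sInf {d | ∃ f ∈ J, f ≠ 0 ∧ f.totalDegree = d}

/-- The symbolic defect: the minimal number of generators one must add to `I(G)^t`
to obtain the symbolic power `I(G)^(t)`. -/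
def sdefect (K : Type*) [Field K] {N : ℕ} (G : SimpleGraph (Fin N)) (t : ℕ) : ℕ :=
  sInf {c | ∃ F : Finset (MvPolynomial (Fin N) K), F.card = c ∧
    symbolicPower K G t = edgeIdeal K G ^ t + Ideal.span (F : Set (MvPolynomial (Fin N) K))}

/-- The graph consisting of the odd cycle on vertices `0, …, 2n` (that is,
`x_1, …, x_{2n+1}`) together with one extra vertex `2n+1` (that is, `x_{2n+2}`)
joined to vertex `0` (that is, `x_1`) by an edge. -/
def appendedCycle (n : ℕ) : SimpleGraph (Fin (2 * n + 2)) :=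
  SimpleGraph.fromRel (fun i j =>
    ((j : ℕ) = (i : ℕ) + 1 ∧ (j : ℕ) ≤ 2 * n) ∨
    ((i : ℕ) = 2 * n ∧ (j : ℕ) = 0) ∨
    ((i : ℕ) = 0 ∧ (j : ℕ) = 2 * n + 1))

/-- polynomials all of whose monomials have `S`-weight at least `t` -/
def wtIdeal (K : Type*) [Field K] {N : ℕ} (S : Finset (Fin N)) (t : ℕ) :
    Ideal (MvPolynomial (Fin N) K) where
  carrier := {f | ∀ a ∈ f.support, t ≤ ∑ i ∈ S, a i}
  zero_mem' := by simp
  add_mem' := by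
    intro f g hf hg a ha
    classical
    rcases Finset.mem_union.1 (MvPolynomial.support_add ha) with h | h
    · exact hf a h
    · exact hg a h
  smul_mem' := by
    intro c f hf a ha
    classical
    obtain ⟨b, _, d, hd, rfl⟩ := Finset.mem_add.1 (MvPolynomial.support_mul c f ha)
    have := hf d hd
    simp only [Finsupp.add_apply, Finset.sum_add_distrib]
    omega

theorem mem_wtIdeal {K : Type*} [Field K] {N : ℕ} {S : Finset (Fin N)} {t : ℕ}
    {f : MvPolynomial (Fin N) K} :
    f ∈ wtIdeal K S t ↔ ∀ a ∈ f.support, t ≤ ∑ i ∈ S, a i := Iff.rfl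

theorem wtIdeal_mul {K : Type*} [Field K] {N : ℕ} (S : Finset (Fin N)) (t u : ℕ) :
    wtIdeal K S t * wtIdeal K S u ≤ wtIdeal K S (t + u) := by
  classical
  rw [Ideal.mul_le]
  intro f hf g hg a ha
  obtain ⟨b, hb, d, hd, rfl⟩ := Finset.mem_add.1 (MvPolynomial.support_mul f g ha)
  have h1 := hf b hb
  have h2 := hg d hd
  simp only [Finsupp.add_apply, Finset.sum_add_distrib]
  omega

theorem pow_le_wtIdeal {K : Type*} [Field K] {N : ℕ} (S : Finset (Fin N)) (u : ℕ)
    (J : Ideal (MvPolynomial (Fin N) K)) (hJ : J ≤ wtIdeal K S u) (t : ℕ) :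
    J ^ t ≤ wtIdeal K S (u * t) := by
  induction t with
  | zero => intro f _ a _; simp
  | succ t ih =>
    rw [pow_succ]
    exact (Ideal.mul_mono ih hJ).trans (by rw [Nat.mul_succ]; exact wtIdeal_mul S _ _)

theorem varIdeal_le_wt {K : Type*} [Field K] {N : ℕ} (S : Finset (Fin N)) :
    varIdeal K N S ≤ wtIdeal K S 1 := by
  unfold varIdeal
  rw [Ideal.span_le]
  rintro _ ⟨i, hi, rfl⟩
  intro a ha
  simp only [MvPolynomial.support_X, Finset.mem_singleton] at ha
  subst ha
  have hi' : i ∈ S := hi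
  simp [Finsupp.single_apply, hi']

theorem edgeIdeal_le_wt {K : Type*} [Field K] {N : ℕ} (G : SimpleGraph (Fin N)) :
    edgeIdeal K G ≤ wtIdeal K Finset.univ 2 := by
  unfold edgeIdeal
  rw [Ideal.span_le]
  rintro _ ⟨i, j, _, rfl⟩
  have h := wtIdeal_mul (K := K) (Finset.univ : Finset (Fin N)) 1 1
  have hX : ∀ i : Fin N, (X i : MvPolynomial (Fin N) K) ∈ wtIdeal K Finset.univ 1 := by
    intro i
    apply varIdeal_le_wt
    exact Ideal.subset_span ⟨i, by simp, rfl⟩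
  exact h (Ideal.mul_mem_mul (hX i) (hX j))

theorem monomial_mem_varIdeal {K : Type*} [Field K] {N : ℕ} (S : Finset (Fin N)) (t : ℕ)
    (a : Fin N →₀ ℕ) (h : t ≤ ∑ i ∈ S, a i) :
    monomial a (1 : K) ∈ varIdeal K N S ^ t := by
  apply Ideal.pow_le_pow_right h
  rw [MvPolynomial.monomial_eq, Finsupp.prod_fintype _ _ (by simp), map_one, one_mul,
    ← Finset.prod_mul_prod_compl S]
  apply Ideal.mul_mem_right
  rw [← Finset.prod_pow_eq_pow_sum]
  apply Ideal.prod_mem_prod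
  intro i hi
  have hX : (X i : MvPolynomial (Fin N) K) ∈ varIdeal K N S := Ideal.subset_span ⟨i, hi, rfl⟩
  exact Ideal.pow_mem_pow hX _

theorem exists_minCover {N : ℕ} (G : SimpleGraph (Fin N)) (S : Finset (Fin N)) :
    IsVertexCover G S → ∃ T ⊆ S, IsMinVertexCover G T := by
  induction S using Finset.strongInduction with
  | H S ih =>
    intro hS
    by_cases h : ∀ T ⊂ S, ¬ IsVertexCover G T
    · exact ⟨S, subset_rfl, hS, h⟩
    · push Not at h
      obtain ⟨T, hT, hc⟩ := h
      obtain ⟨U, hU, hm⟩ := ih T hT hc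
      exact ⟨U, hU.trans hT.subset, hm⟩

theorem sum_shift {N : ℕ} (a a' : Fin N →₀ ℕ) (p q : Fin N) (w : ℕ)
    (h : a = a' + Finsupp.single p w + Finsupp.single q w) (T : Finset (Fin N)) :
    ∑ i ∈ T, a i = ∑ i ∈ T, a' i + (if p ∈ T then w else 0) + (if q ∈ T then w else 0) := by
  subst h
  simp [Finset.sum_add_distrib, Finsupp.single_apply, Finset.sum_ite_eq]

theorem exists_shift {N : ℕ} (a : Fin N →₀ ℕ) (p q : Fin N) (hpq : p ≠ q) (w : ℕ)
    (hp : w ≤ a p) (hq : w ≤ a q) :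
    ∃ a' : Fin N →₀ ℕ, a = a' + Finsupp.single p w + Finsupp.single q w := by
  refine ⟨a - (Finsupp.single p w + Finsupp.single q w), ?_⟩
  rw [add_assoc, tsub_add_cancel_of_le]
  intro i
  simp only [Finsupp.add_apply, Finsupp.single_apply]
  split_ifs with h1 h2 h2
  · exact absurd (h1.trans h2.symm) hpq
  · subst h1; simpa
  · subst h2; simpa
  · simp

theorem mem_of_shift {K : Type*} [Field K] {N : ℕ} (G : SimpleGraph (Fin N))
    (a a' : Fin N →₀ ℕ) (p q : Fin N) (w k : ℕ) (hadj : G.Adj p q)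
    (h : a = a' + Finsupp.single p w + Finsupp.single q w)
    (hm : monomial a' (1 : K) ∈ edgeIdeal K G ^ (k - w)) :
    monomial a (1 : K) ∈ edgeIdeal K G ^ k := by
  have e : monomial a (1 : K) = monomial a' 1 * (X p * X q) ^ w := by
    subst h
    rw [mul_pow, MvPolynomial.X_pow_eq_monomial, MvPolynomial.X_pow_eq_monomial,
      MvPolynomial.monomial_mul, MvPolynomial.monomial_mul, add_assoc]
    simp
  rw [e]
  apply Ideal.pow_le_pow_right (show k ≤ (k - w) + w by omega)
  rw [pow_add]
  have hX : (X p * X q : MvPolynomial (Fin N) K) ∈ edgeIdeal K G :=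
    Ideal.subset_span ⟨p, q, hadj, rfl⟩
  exact Ideal.mul_mem_mul hm (Ideal.pow_mem_pow hX _)

theorem path_mem {K : Type*} [Field K] {N : ℕ} (G : SimpleGraph (Fin N))
    (hG : ∀ i j : Fin N, (j : ℕ) = i + 1 → G.Adj i j) (m : ℕ) :
    m < N → ∀ (a : Fin N →₀ ℕ) (k : ℕ),
    (∀ T : Finset (Fin N), (∀ i ∈ T, (i : ℕ) ≤ m) →
      (∀ i j : Fin N, (j : ℕ) = i + 1 → (j : ℕ) ≤ m → i ∈ T ∨ j ∈ T) → k ≤ ∑ i ∈ T, a i) →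
    monomial a (1 : K) ∈ edgeIdeal K G ^ k := by
  induction m with
  | zero =>
    intro _ a k h
    have := h ∅ (by simp) (by intro i j h1 h2; omega)
    simp at this
    subst this
    simp
  | succ m ih =>
    intro hm a k h
    let p : Fin N := ⟨m, by omega⟩
    let q : Fin N := ⟨m + 1, hm⟩
    have hpq : p ≠ q := by simp [p, q]
    set w := min (a p) (a q) with hw
    obtain ⟨a', ha'⟩ := exists_shift a p q hpq w (min_le_left _ _) (min_le_right _ _)
    apply mem_of_shift G a a' p q w k (hG p q rfl) ha'
    apply ih (by omega)
    intro T hT1 hT2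
    have hs := sum_shift a a' p q w ha' T
    have hqT : q ∉ T := fun hq => by have := hT1 q hq; simp [q] at this
    have hcov : ∀ T' : Finset (Fin N), T ⊆ T' → (p ∈ T' ∨ q ∈ T') →
        ∀ i j : Fin N, (j : ℕ) = i + 1 → (j : ℕ) ≤ m + 1 → i ∈ T' ∨ j ∈ T' := by
      intro T' hTT hor i j hij hj
      rcases Nat.lt_or_ge m j with hlt | hge
      · have h1 : i = p := Fin.ext (by simp [p]; omega)
        have h2 : j = q := Fin.ext (by simp [q]; omega)
        rw [h1, h2]; exact hor
      · exact (hT2 i j hij hge).imp (fun x => hTT x) (fun x => hTT x)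
    by_cases hpT : p ∈ T
    · have := h T (fun i hi => (hT1 i hi).trans (by omega)) (hcov T subset_rfl (Or.inl hpT))
      simp only [hpT, hqT, if_true, if_false] at hs
      omega
    · have h1 := h (insert p T) (by
        intro i hi
        rcases Finset.mem_insert.1 hi with rfl | hi
        · simp [p]
        · have := hT1 i hi; omega) (hcov _ (Finset.subset_insert _ _) (by simp))
      have h2 := h (insert q T) (by
        intro i hi
        rcases Finset.mem_insert.1 hi with rfl | hi
        · simp [q]
        · have := hT1 i hi; omega) (hcov _ (Finset.subset_insert _ _) (by simp))
      rw [Finset.sum_insert hpT] at h1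
      rw [Finset.sum_insert hqT] at h2
      simp only [hpT, hqT, if_false] at hs
      omega

theorem cycle_adj_succ (n : ℕ) (hn : 1 ≤ n) (i j : Fin (2 * n + 1)) (h : (j : ℕ) = i + 1) :
    (cycleGraph (2 * n + 1)).Adj i j := by
  unfold cycleGraph
  rw [SimpleGraph.fromRel_adj]
  refine ⟨fun e => by rw [e] at h; omega, Or.inl ?_⟩
  rw [Nat.mod_eq_of_lt (by have := j.2; omega)]
  exact h

theorem cycle_cover (n : ℕ) (T : Finset (Fin (2 * n + 1)))
    (hT : ∀ i j : Fin (2 * n + 1), (j : ℕ) = i + 1 → i ∈ T ∨ j ∈ T)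
    (h0 : (0 : Fin (2 * n + 1)) ∈ T ∨ Fin.last (2 * n) ∈ T) :
    IsVertexCover (cycleGraph (2 * n + 1)) T := by
  have key : ∀ i j : Fin (2 * n + 1), (j : ℕ) = ((i : ℕ) + 1) % (2 * n + 1) → i ∈ T ∨ j ∈ T := by
    intro i j h
    by_cases hi : (i : ℕ) = 2 * n
    · have h1 : i = Fin.last (2 * n) := Fin.ext (by simp [hi])
      have h2 : j = 0 := Fin.ext (by rw [h, hi]; simp)
      rw [h1, h2]; exact h0.symm
    · apply hT
      rw [h, Nat.mod_eq_of_lt (by have := i.2; omega)]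
  intro i j hij
  unfold cycleGraph at hij
  rw [SimpleGraph.fromRel_adj] at hij
  rcases hij.2 with h | h
  · exact key i j h
  · exact (key j i h).symm

theorem cycle_mem {K : Type*} [Field K] (n : ℕ) (hn : 1 ≤ n) (a : Fin (2 * n + 1) →₀ ℕ) (s : ℕ)
    (hdeg : 2 * s ≤ ∑ i, a i)
    (hcov : ∀ S, IsVertexCover (cycleGraph (2 * n + 1)) S → s ≤ ∑ i ∈ S, a i) :
    monomial a (1 : K) ∈ edgeIdeal K (cycleGraph (2 * n + 1)) ^ s := by
  classical
  let p : Fin (2 * n + 1) := 0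
  let q : Fin (2 * n + 1) := Fin.last (2 * n)
  have hpq : p ≠ q := by
    intro h
    have := congrArg Fin.val h
    simp [p, q] at this
    omega
  let PC : Finset (Fin (2 * n + 1)) → Prop := fun T =>
    ∀ i j : Fin (2 * n + 1), (j : ℕ) = i + 1 → i ∈ T ∨ j ∈ T
  have hPC : ∀ T, PC T → (p ∈ T ∨ q ∈ T) → s ≤ ∑ i ∈ T, a i :=
    fun T h1 h2 => hcov T (cycle_cover n T h1 h2)
  have hmono : ∀ T v, PC T → PC (insert v T) := by
    intro T v h i j hij
    exact (h i j hij).imp (Finset.mem_insert_of_mem) (Finset.mem_insert_of_mem)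
  let A : Finset (Finset (Fin (2 * n + 1))) :=
    Finset.univ.filter fun T => PC T ∧ p ∉ T ∧ q ∉ T
  let c := A.sup fun T => s - ∑ i ∈ T, a i
  have hc1 : ∀ T, PC T → p ∉ T → q ∉ T → s ≤ ∑ i ∈ T, a i + c := by
    intro T h1 h2 h3
    have : s - ∑ i ∈ T, a i ≤ c :=
      Finset.le_sup (f := fun T => s - ∑ i ∈ T, a i) (by simp [A, h1, h2, h3])
    omega
  have hc2 : c ≤ a p := by
    apply Finset.sup_le
    intro T hT
    obtain ⟨h1, h2, h3⟩ := (Finset.mem_filter.1 hT).2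
    have := hPC _ (hmono T p h1) (by simp)
    rw [Finset.sum_insert h2] at this
    omega
  have hc3 : c ≤ a q := by
    apply Finset.sup_le
    intro T hT
    obtain ⟨h1, h2, h3⟩ := (Finset.mem_filter.1 hT).2
    have := hPC _ (hmono T q h1) (by simp)
    rw [Finset.sum_insert h3] at this
    omega
  have hc4 : ∀ U, PC U → p ∈ U → q ∈ U → s + c ≤ ∑ i ∈ U, a i := by
    intro U hU hpU hqU
    have hsU := hPC U hU (Or.inl hpU)
    have : c ≤ ∑ i ∈ U, a i - s := by
      apply Finset.sup_le
      intro T hT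
      obtain ⟨h1, h2, h3⟩ := (Finset.mem_filter.1 hT).2
      have : 2 * s ≤ ∑ i ∈ T, a i + ∑ i ∈ U, a i := by
        by_cases hall : ∀ v, v ∈ T ∨ v ∈ U
        · have e : T ∪ U = Finset.univ := by ext v; simp [hall v]
          rw [← Finset.sum_union_inter, e]
          omega
        · push Not at hall
          obtain ⟨v, hvT, hvU⟩ := hall
          have hvp : p < v := by
            rcases (Fin.zero_le v).lt_or_eq with h | h
            · exact h
            · exact absurd (h ▸ hpU) hvU
          have hvq : v < q := by
            rcases (Fin.le_last v).lt_or_eq with h | h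
            · exact h
            · exact absurd (h ▸ hqU) hvU
          let mix : Finset (Fin (2 * n + 1)) → Finset (Fin (2 * n + 1)) →
              Finset (Fin (2 * n + 1)) := fun T U =>
            Finset.univ.filter fun i => if i < v then i ∈ T else i ∈ U
          have hmix : ∀ T U, PC T → PC U → v ∉ T → v ∉ U → PC (mix T U) := by
            intro T U hT hU hvT hvU i j hij
            have hT' := hT i j hij
            have hU' := hU i j hij
            simp only [mix, Finset.mem_filter, Finset.mem_univ, true_and]
            by_cases hi : i < v
            · by_cases hj : j < v
              · simpa [hi, hj] using hT'
              · have : j = v := by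
                  apply Fin.ext
                  have h1 : (i : ℕ) < v := hi
                  have h2 : ¬ (j : ℕ) < v := hj
                  omega
                subst this
                simp only [hi, if_true]
                exact Or.inl (hT'.resolve_right hvT)
            · have hj : ¬ j < v := by
                have h1 : ¬ (i : ℕ) < v := hi
                intro h2
                have h2 : (j : ℕ) < v := h2
                omega
              simpa [hi, hj] using hU'
          have m1 := hPC _ (hmix T U h1 hU hvT hvU) (Or.inr (by simp [mix, hvq.not_gt, hqU]))
          have m2 := hPC _ (hmix U T hU h1 hvU hvT) (Or.inl (by simp [mix, hvp, hpU]))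
          have e : ∑ i ∈ mix T U, a i + ∑ i ∈ mix U T, a i = ∑ i ∈ T, a i + ∑ i ∈ U, a i := by
            have hT : T = Finset.univ.filter (· ∈ T) := by simp
            have hU : U = Finset.univ.filter (· ∈ U) := by simp
            conv_rhs => rw [hT, hU]
            simp only [mix, Finset.sum_filter, ← Finset.sum_add_distrib]
            apply Finset.sum_congr rfl
            intro i _
            by_cases hi : i < v
            · simp [hi]
            · simp [hi, add_comm]
          omega
      omega
    omega
  obtain ⟨a', ha'⟩ := exists_shift a p q hpq c hc2 hc3
  have hadj : (cycleGraph (2 * n + 1)).Adj p q := by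
    unfold cycleGraph
    rw [SimpleGraph.fromRel_adj]
    exact ⟨hpq, Or.inr (by simp [p, q])⟩
  apply mem_of_shift _ a a' p q c s hadj ha'
  apply path_mem _ (cycle_adj_succ n hn) (2 * n) (by omega)
  intro T _ hT
  have hT' : PC T := fun i j hij => hT i j hij (by have := j.2; omega)
  have hs := sum_shift a a' p q c ha' T
  by_cases h1 : p ∈ T <;> by_cases h2 : q ∈ T <;> simp only [h1, h2, if_true, if_false] at hs
  · have := hc4 T hT' h1 h2; omega
  · have := hPC T hT' (Or.inl h1); omega
  · have := hPC T hT' (Or.inr h2); omega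
  · have := hc1 T hT' h1 h2; omega

theorem alphaDeg_le {K : Type*} [Field K] {N : ℕ} (J : Ideal (MvPolynomial (Fin N) K))
    (a : Fin N →₀ ℕ) (h : monomial a (1 : K) ∈ J) : alphaDeg J ≤ ∑ i, a i := by
  apply Nat.sInf_le
  refine ⟨_, h, by simp, ?_⟩
  rw [MvPolynomial.totalDegree_monomial _ one_ne_zero, Finsupp.sum_fintype _ _ (by simp)]

theorem le_alphaDeg_of_le {K : Type*} [Field K] {N : ℕ} (J L : Ideal (MvPolynomial (Fin N) K))
    (h : J ≤ L) (hJ : J ≠ ⊥) : alphaDeg L ≤ alphaDeg J := by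
  obtain ⟨f, hf, hf0⟩ := Submodule.exists_mem_ne_zero_of_ne_bot hJ
  obtain ⟨g, hg, hg0, hd⟩ := Nat.sInf_mem (s := {d | ∃ f ∈ J, f ≠ 0 ∧ f.totalDegree = d})
    ⟨_, f, hf, hf0, rfl⟩
  exact Nat.sInf_le ⟨g, h hg, hg0, hd⟩

theorem le_alphaDeg {K : Type*} [Field K] {N : ℕ} (J : Ideal (MvPolynomial (Fin N) K)) (d : ℕ)
    (h : J ≤ wtIdeal K Finset.univ d) (hJ : J ≠ ⊥) : d ≤ alphaDeg J := by
  obtain ⟨f, hf, hf0⟩ := Submodule.exists_mem_ne_zero_of_ne_bot hJ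
  obtain ⟨g, hg, hg0, hd⟩ := Nat.sInf_mem (s := {d | ∃ f ∈ J, f ≠ 0 ∧ f.totalDegree = d})
    ⟨_, f, hf, hf0, rfl⟩
  obtain ⟨a, ha⟩ := MvPolynomial.support_nonempty.2 hg0
  have h1 := h hg a ha
  have h2 := MvPolynomial.le_totalDegree ha
  rw [Finsupp.sum_fintype _ _ (by simp)] at h2
  unfold alphaDeg
  omega

theorem monomial_mem_symbolic {K : Type*} [Field K] {N : ℕ} (G : SimpleGraph (Fin N)) (t : ℕ)
    (a : Fin N →₀ ℕ) (h : ∀ S, IsMinVertexCover G S → t ≤ ∑ i ∈ S, a i) :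
    monomial a (1 : K) ∈ symbolicPower K G t := by
  unfold symbolicPower
  simp only [Submodule.mem_iInf]
  exact fun S hS => monomial_mem_varIdeal S t a (h S hS)

theorem symbolic_support {K : Type*} [Field K] {N : ℕ} (G : SimpleGraph (Fin N)) (t : ℕ)
    (f : MvPolynomial (Fin N) K) (hf : f ∈ symbolicPower K G t) (a : Fin N →₀ ℕ)
    (ha : a ∈ f.support) (S : Finset (Fin N)) (hS : IsMinVertexCover G S) :
    t ≤ ∑ i ∈ S, a i := by
  unfold symbolicPower at hf
  simp only [Submodule.mem_iInf] at hf
  have := pow_le_wtIdeal S 1 _ (varIdeal_le_wt S) t (hf S hS) a ha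
  omega

/-- For the edge ideal `I` of an odd cycle, `α(I^(t)) < α(I^s)` iff
`I^(t) ⊄ I^s`. -/
theorem alpha_lt_iff_not_le (K : Type*) [Field K] (n s t : ℕ)
    (hn : 1 ≤ n) (hs : 1 ≤ s) (ht : 1 ≤ t) :
    alphaDeg (symbolicPower K (cycleGraph (2 * n + 1)) t)
        < alphaDeg (edgeIdeal K (cycleGraph (2 * n + 1)) ^ s)
      ↔ ¬ symbolicPower K (cycleGraph (2 * n + 1)) t
          ≤ edgeIdeal K (cycleGraph (2 * n + 1)) ^ s := by
  set G := cycleGraph (2 * n + 1) with hGdef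
  let p : Fin (2 * n + 1) := ⟨0, by omega⟩
  let q : Fin (2 * n + 1) := ⟨1, by omega⟩
  have hadj : G.Adj p q := cycle_adj_succ n hn p q rfl
  let e : ℕ → (Fin (2 * n + 1) →₀ ℕ) := fun w => 0 + Finsupp.single p w + Finsupp.single q w
  have hesum : ∀ w T, ∑ i ∈ T, e w i =
      (if p ∈ T then w else 0) + (if q ∈ T then w else 0) := by
    intro w T
    rw [sum_shift (e w) 0 p q w rfl T]
    simp
  have hedeg : ∀ w, ∑ i, e w i = 2 * w := by
    intro w
    rw [hesum]
    simp
    omega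
  have heS : monomial (e t) (1 : K) ∈ symbolicPower K G t := by
    apply monomial_mem_symbolic
    intro S hS
    rw [hesum]
    rcases hS.1 hadj with h | h <;> simp [h]
  have heI : monomial (e s) (1 : K) ∈ edgeIdeal K G ^ s :=
    mem_of_shift G (e s) 0 p q s s hadj rfl (by simp)
  have hS0 : symbolicPower K G t ≠ ⊥ := by
    intro h
    rw [h] at heS
    simp at heS
  have hI0 : edgeIdeal K G ^ s ≠ ⊥ := by
    intro h
    rw [h] at heI
    simp only [Ideal.mem_bot, MvPolynomial.monomial_eq_zero, one_ne_zero] at heI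
  constructor
  · intro hlt hle
    have := le_alphaDeg_of_le _ _ hle hS0
    omega
  · intro hnle
    by_contra hge
    apply hnle
    have h2s := le_alphaDeg _ (2 * s) (pow_le_wtIdeal _ 2 _ (edgeIdeal_le_wt G) s) hI0
    have h2t := alphaDeg_le _ _ heS
    rw [hedeg] at h2t
    intro f hf
    rw [f.as_sum]
    apply Ideal.sum_mem
    intro a ha
    have hw := symbolic_support G t f hf a ha
    have hd := alphaDeg_le _ _ (monomial_mem_symbolic (K := K) G t a hw)
    have hm : monomial a (1 : K) ∈ edgeIdeal K G ^ s := by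
      apply cycle_mem n hn a s (by omega)
      intro S hS
      obtain ⟨T, hTS, hT⟩ := exists_minCover _ S hS
      have h1 := hw T hT
      have h2 : ∑ i ∈ T, a i ≤ ∑ i ∈ S, a i := Finset.sum_le_sum_of_subset hTS
      omega
    have hC := Ideal.mul_mem_left _ (C (f.coeff a)) hm
    rwa [MvPolynomial.C_mul_monomial, mul_one] at hC
end
end

section
/- Let I = I(C_{2n+1}) be the edge ideal of the odd cycle C_{2n+1}. Then the resurgence of I equals (2n+2)/(2n+1); that is, the supremum (as a real number) of the set { m/r : m, r positive integers with I^(m) ⊄ I^r } is (2n+2)/(2n+1). -/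
open MvPolynomial

noncomputable section

open Finset in
lemma path_konig (b : ℕ → ℕ) (L : ℕ) : ∃ z c0 c1 : ℕ → ℕ, ∃ ρ : ℕ,
    (∀ i, c0 i ≤ 1) ∧ (∀ i, c1 i ≤ 1) ∧ (∀ i < L, 1 ≤ c0 i + c0 (i+1)) ∧
    (∀ i < L, 1 ≤ c1 i + c1 (i+1)) ∧ c1 L = 1 ∧
    (∑ i ∈ range (L+1), c0 i * b i = ∑ i ∈ range (L+1), z i) ∧
    (∑ i ∈ range (L+1), c1 i * b i = ∑ i ∈ range (L+1), z i + ρ) ∧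
    z 0 = 0 ∧ (∀ i < L, z i + z (i+1) ≤ b i) ∧ z L + ρ = b L := by
  induction L with
  | zero =>
    exact ⟨fun _ => 0, fun _ => 0, fun _ => 1, b 0, by simp⟩
  | succ L ih =>
    obtain ⟨z, c0, c1, ρ, h1, h2, h3, h4, h5, h6, h7, h8, h9, h10⟩ := ih
    have key : ∀ (f g : ℕ → ℕ) (v : ℕ), ∑ i ∈ range (L+1+1), (Function.update f (L+1) v) i * g i
        = ∑ i ∈ range (L+1), f i * g i + v * g (L+1) := by
      intro f g v
      rw [sum_range_succ]
      congr 1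
      · apply sum_congr rfl
        intro i hi
        have : i ≠ L + 1 := by have := mem_range.1 hi; omega
        simp [Function.update_of_ne this]
      · simp
    have key2 : ∀ (f : ℕ → ℕ) (v : ℕ), ∑ i ∈ range (L+1+1), (Function.update f (L+1) v) i
        = ∑ i ∈ range (L+1), f i + v := by
      intro f v
      simpa using key f (fun _ => 1) v
    have upd : ∀ (f : ℕ → ℕ) (v i : ℕ), (Function.update f (L+1) v) i = if i = L+1 then v else f i := by
      intro f v i
      simp [Function.update_apply]
    have hc0 : ∀ i < L+1, 1 ≤ Function.update c0 (L+1) 1 i + Function.update c0 (L+1) 1 (i+1) := by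
      intro i hi
      have := h3 i
      simp only [upd]
      split_ifs <;> omega
    have hc0' : ∀ i, Function.update c0 (L+1) 1 i ≤ 1 := by
      intro i
      have := h1 i
      simp only [upd]
      split_ifs <;> omega
    by_cases hρ : ρ ≤ b (L+1)
    · refine ⟨Function.update z (L+1) ρ, Function.update c1 (L+1) 0, Function.update c0 (L+1) 1,
        b (L+1) - ρ, ?_, hc0', ?_, hc0, by simp, ?_, ?_, ?_, ?_, ?_⟩
      · intro i
        have := h2 i
        simp only [upd]
        split_ifs <;> omega
      · intro i hi
        have := h4 i
        simp only [upd]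
        by_cases hiL : i = L
        · subst hiL; simp; omega
        · rw [if_neg (by omega), if_neg (by omega)]; omega
      · rw [key, key2]; omega
      · rw [key, key2]; omega
      · simp [h8]
      · intro i hi
        have := h9 i
        simp only [upd]
        by_cases hiL : i = L
        · subst hiL; simp; omega
        · rw [if_neg (by omega), if_neg (by omega)]; omega
      · simp; omega
    · refine ⟨Function.update z (L+1) (b (L+1)), Function.update c0 (L+1) 1,
        Function.update c0 (L+1) 1, 0, hc0', hc0', hc0, hc0, by simp, ?_, ?_, ?_, ?_, ?_⟩
      · rw [key, key2]; omega
      · rw [key, key2]; omega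
      · simp [h8]
      · intro i hi
        have := h9 i
        simp only [upd]
        by_cases hiL : i = L
        · subst hiL; simp; omega
        · rw [if_neg (by omega), if_neg (by omega)]; omega
      · simp

open Finset in
lemma swap_covers (a c d : ℕ → ℕ) (n r : ℕ)
    (hcov : ∀ c : ℕ → ℕ, (∀ i, c i ≤ 1) → (∀ i < 2*n, 1 ≤ c i + c (i+1)) → 1 ≤ c (2*n) + c 0 →
      r ≤ ∑ i ∈ range (2*n+1), c i * a i)
    (hsum : 2 * r ≤ ∑ i ∈ range (2*n+1), a i)
    (hc : ∀ i, c i ≤ 1) (hc' : ∀ i < 2*n, 1 ≤ c i + c (i+1)) (hc0 : c 0 = 0) (hcn : c (2*n) = 0)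
    (hd : ∀ i, d i ≤ 1) (hd' : ∀ i < 2*n, 1 ≤ d i + d (i+1)) (hd0 : d 0 = 1) (hdn : d (2*n) = 1) :
    2 * r ≤ ∑ i ∈ range (2*n+1), c i * a i + ∑ i ∈ range (2*n+1), d i * a i := by
  by_cases hsw : ∃ j < 2*n, 1 ≤ c j + d (j+1) ∧ 1 ≤ d j + c (j+1)
  · obtain ⟨j, hj, hj1, hj2⟩ := hsw
    have e : ∀ c d : ℕ → ℕ, (∀ i, c i ≤ 1) → (∀ i, d i ≤ 1) → (∀ i < 2*n, 1 ≤ c i + c (i+1)) →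
        (∀ i < 2*n, 1 ≤ d i + d (i+1)) → 1 ≤ c j + d (j+1) → 1 ≤ d (2*n) + c 0 →
        r ≤ ∑ i ∈ range (2*n+1), (if i ≤ j then c i else d i) * a i := by
      intro c d hc hd hc' hd' h1 h2
      apply hcov
      · intro i
        have := hc i
        have := hd i
        split_ifs <;> omega
      · intro i hi
        have := hc' i hi
        have := hd' i hi
        by_cases hij : i = j
        · subst hij; simp; omega
        · split_ifs <;> omega
      · rw [if_neg (by omega), if_pos (by omega)]; omega
    have e1 := e c d hc hd hc' hd' hj1 (by omega)
    have e2 := e d c hd hc hd' hc' hj2 (by omega)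
    have : ∑ i ∈ range (2*n+1), (if i ≤ j then c i else d i) * a i +
        ∑ i ∈ range (2*n+1), (if i ≤ j then d i else c i) * a i =
        ∑ i ∈ range (2*n+1), c i * a i + ∑ i ∈ range (2*n+1), d i * a i := by
      rw [← sum_add_distrib, ← sum_add_distrib]
      apply sum_congr rfl
      intro i _
      split_ifs <;> ring
    omega
  · push Not at hsw
    have h1 : ∀ i, i ≤ 2*n → c i + d i = 1 := by
      intro i
      induction i with
      | zero => intro _; omega
      | succ i ih =>
        intro hi
        have := ih (by omega)
        have := hsw i (by omega)
        have := hc' i (by omega)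
        have := hd' i (by omega)
        have := hc (i+1)
        have := hd (i+1)
        omega
    rw [← sum_add_distrib]
    refine hsum.trans (le_of_eq (sum_congr rfl ?_))
    intro i hi
    rw [← add_mul, h1 i (by have := mem_range.1 hi; omega), one_mul]

open Finset in
lemma cycle_matching (a : ℕ → ℕ) (n r : ℕ) (hn : 1 ≤ n)
    (hcov : ∀ c : ℕ → ℕ, (∀ i, c i ≤ 1) → (∀ i < 2*n, 1 ≤ c i + c (i+1)) → 1 ≤ c (2*n) + c 0 →
      r ≤ ∑ i ∈ range (2*n+1), c i * a i)
    (hsum : 2 * r ≤ ∑ i ∈ range (2*n+1), a i) :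
    ∃ z : ℕ → ℕ, (∀ i < 2*n, z i + z (i+1) ≤ a i) ∧ z (2*n) + z 0 ≤ a (2*n) ∧
      r ≤ ∑ i ∈ range (2*n+1), z i := by
  classical
  let P : ℕ → Prop := fun t => ∀ c : ℕ → ℕ, (∀ i, c i ≤ 1) → (∀ i < 2*n, 1 ≤ c i + c (i+1)) →
    c 0 = 0 → c (2*n) = 0 → r ≤ ∑ i ∈ range (2*n+1), c i * a i + t
  have hP : ∃ t, P t := ⟨r, fun c _ _ _ _ => by omega⟩
  have updsum : ∀ (c g : ℕ → ℕ) (j v : ℕ), j ≤ 2*n → c j = 0 →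
      ∑ i ∈ range (2*n+1), Function.update c j v i * g i =
      ∑ i ∈ range (2*n+1), c i * g i + v * g j := by
    intro c g j v hj hcj
    have hm : j ∈ range (2*n+1) := mem_range.2 (by omega)
    rw [← add_sum_erase _ _ hm, ← add_sum_erase (range (2*n+1)) (fun i => c i * g i) hm]
    simp only [Function.update_self, hcj]
    have : ∑ x ∈ (range (2*n+1)).erase j, Function.update c j v x * g x =
        ∑ x ∈ (range (2*n+1)).erase j, c x * g x := by
      apply sum_congr rfl
      intro x hx
      rw [Function.update_of_ne (ne_of_mem_erase hx)]
    rw [this]; ring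
  obtain ⟨t, ht, hboth, ht0, htn⟩ : ∃ t, P t ∧ (∀ d : ℕ → ℕ, (∀ i, d i ≤ 1) →
      (∀ i < 2*n, 1 ≤ d i + d (i+1)) → d 0 = 1 → d (2*n) = 1 →
      r + t ≤ ∑ i ∈ range (2*n+1), d i * a i) ∧ t ≤ a 0 ∧ t ≤ a (2*n) := by
    refine ⟨Nat.find hP, Nat.find_spec hP, ?_⟩
    rcases Nat.eq_zero_or_pos (Nat.find hP) with h0 | h0
    · rw [h0]
      refine ⟨fun d h1 h2 h3 h4 => ?_, by omega, by omega⟩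
      exact hcov d h1 h2 (by omega)
    · have hmin := Nat.find_min hP (m := Nat.find hP - 1) (by omega)
      simp only [P] at hmin
      push Not at hmin
      obtain ⟨c, h1, h2, h3, h4, h5⟩ := hmin
      refine ⟨fun d k1 k2 k3 k4 => ?_, ?_, ?_⟩
      · have := swap_covers a c d n r hcov hsum h1 h2 h3 h4 k1 k2 k3 k4
        omega
      · have := hcov (Function.update c 0 1) ?_ ?_ ?_
        · rw [updsum c a 0 1 (by omega) h3] at this
          omega
        · intro i; have := h1 i; simp only [Function.update_apply]; split_ifs <;> omega
        · intro i hi; have := h2 i hi; simp only [Function.update_apply]; split_ifs <;> omega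
        · simp
      · have := hcov (Function.update c (2*n) 1) ?_ ?_ ?_
        · rw [updsum c a (2*n) 1 (by omega) h4] at this
          omega
        · intro i; have := h1 i; simp only [Function.update_apply]; split_ifs <;> omega
        · intro i hi; have := h2 i hi; simp only [Function.update_apply]; split_ifs <;> omega
        · simp
  let b : ℕ → ℕ := fun i => a i - (if i = 0 then t else 0) - (if i = 2*n then t else 0)
  have hb : ∀ i, b i + (if i = 0 then t else 0) + (if i = 2*n then t else 0) = a i := by
    intro i
    simp only [b]
    by_cases h : i = 0
    · subst h; rw [if_pos rfl, if_neg (by omega)]; omega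
    · by_cases h' : i = 2*n
      · subst h'; rw [if_pos rfl, if_neg (by omega)]; omega
      · simp [h, h']
  obtain ⟨z, c, _, ρ, h1, _, h3, _, _, h6, _, h8, h9, h10⟩ := path_konig b (2*n)
  have hw : ∑ i ∈ range (2*n+1), c i * a i = ∑ i ∈ range (2*n+1), c i * b i + c 0 * t + c (2*n) * t := by
    have : ∀ i ∈ range (2*n+1), c i * a i = c i * b i + (if i = 0 then c i * t else 0) +
        (if i = 2*n then c i * t else 0) := by
      intro i _
      rw [← hb i]
      split_ifs <;> ring
    rw [sum_congr rfl this, sum_add_distrib, sum_add_distrib, sum_ite_eq', sum_ite_eq']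
    simp
  refine ⟨Function.update z 0 t, ?_, ?_, ?_⟩
  · intro i hi
    have e1 := h9 i hi
    have e2 := hb i
    rw [if_neg (by omega : ¬ i = 2*n)] at e2
    rw [Function.update_of_ne (by omega : i+1 ≠ 0)]
    by_cases h : i = 0
    · subst h; simp only [zero_add] at e1; simp at e2 ⊢; omega
    · rw [Function.update_of_ne h]; simp [h] at e2; omega
  · rw [Function.update_of_ne (by omega : 2*n ≠ 0)]
    have e2 := hb (2*n)
    rw [if_pos rfl, if_neg (by omega)] at e2
    simp; omega
  · have hs := updsum z (fun _ => 1) 0 t (by omega) h8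
    simp only [mul_one] at hs
    rw [hs, ← h6]
    have k1 := h1 0
    have k2 := h1 (2*n)
    have c1 := ht c h1 h3
    have c2 := hboth c h1 h3
    have c3 := hcov c h1 h3
    rw [hw] at c1 c2 c3
    have q0 : c 0 = 0 ∨ c 0 = 1 := by omega
    have q1 : c (2*n) = 0 ∨ c (2*n) = 1 := by omega
    rcases q0 with q0 | q0 <;> rcases q1 with q1 | q1 <;> simp [q0, q1] at c1 c2 c3 <;> omega

lemma varIdeal_pow_support {K : Type*} [Field K] {N : ℕ} (S : Finset (Fin N)) (t : ℕ)
    (f : MvPolynomial (Fin N) K) (hf : f ∈ varIdeal K N S ^ t) :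
    ∀ a ∈ f.support, t ≤ ∑ i ∈ S, a i := by
  have key : ∀ t : ℕ, varIdeal K N S ^ t ≤
      Ideal.span ((fun s => monomial s (1 : K)) '' {a : Fin N →₀ ℕ | t ≤ ∑ i ∈ S, a i}) := by
    intro t
    induction t with
    | zero =>
      intro f _
      rw [mem_ideal_span_monomial_image]
      intro a _
      exact ⟨a, by simp, le_rfl⟩
    | succ t ih =>
      rw [pow_succ]
      refine (Ideal.mul_mono_left ih).trans ?_
      rw [varIdeal, Ideal.span_mul_span', Ideal.span_le]
      rintro _ ⟨_, ⟨a, ha, rfl⟩, _, ⟨i, hi, rfl⟩, rfl⟩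
      apply Ideal.subset_span
      refine ⟨a + Finsupp.single i 1, ?_, ?_⟩
      · simp only [Set.mem_ofPred_eq] at ha ⊢
        simp only [Finsupp.add_apply, Finset.sum_add_distrib]
        have : ∑ x ∈ S, (Finsupp.single i 1 : Fin N →₀ ℕ) x = 1 := by
          classical
          simp only [Finsupp.single_apply]
          rw [Finset.sum_ite_eq]
          simp at hi
          simp [hi]
        omega
      · simp [X, monomial_mul]
  have := key t hf
  rw [mem_ideal_span_monomial_image] at this
  intro a ha
  obtain ⟨b, hb, hba⟩ := this a ha
  exact le_trans hb (Finset.sum_le_sum fun i _ => hba i)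

lemma cycle_adj {N : ℕ} [NeZero N] (hN : 2 ≤ N) (i : Fin N) : (cycleGraph N).Adj i (i+1) := by
  have h1 : ((i + 1 : Fin N) : ℕ) = (i.val + 1) % N := by
    rw [Fin.val_add]
    simp [Nat.mod_eq_of_lt (by omega : 1 < N)]
  rw [cycleGraph, SimpleGraph.fromRel_adj]
  refine ⟨?_, Or.inl h1⟩
  intro h
  have h2 := congrArg Fin.val h
  rw [h1] at h2
  have := i.2
  rcases Nat.lt_or_ge (i.val + 1) N with h3 | h3
  · rw [Nat.mod_eq_of_lt h3] at h2; omega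
  · have : i.val + 1 = N := by omega
    rw [this, Nat.mod_self] at h2; omega

lemma cycle_adj_iff {N : ℕ} [NeZero N] (hN : 2 ≤ N) {i j : Fin N} (h : (cycleGraph N).Adj i j) :
    j = i + 1 ∨ i = j + 1 := by
  rw [cycleGraph, SimpleGraph.fromRel_adj] at h
  have e : ∀ i j : Fin N, (j : ℕ) = (i.val + 1) % N → j = i + 1 := by
    intro i j h
    apply Fin.ext
    rw [h, Fin.val_add]
    simp [Nat.mod_eq_of_lt (by omega : 1 < N)]
  exact h.2.imp (e i j) (e j i)

lemma exists_min_cover {N : ℕ} (G : SimpleGraph (Fin N)) (S : Finset (Fin N))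
    (h : IsVertexCover G S) : ∃ T ⊆ S, IsMinVertexCover G T := by
  induction S using Finset.strongInduction with
  | H S ih =>
    by_cases hm : ∃ T ⊂ S, IsVertexCover G T
    · obtain ⟨T, hT, hc⟩ := hm
      obtain ⟨U, hU, hmin⟩ := ih T hT hc
      exact ⟨U, hU.trans hT.1, hmin⟩
    · push Not at hm
      exact ⟨S, subset_rfl, h, hm⟩

/-- monomials dominated by a fractional edge assignment lie in the power. -/
lemma monomial_mem_pow {K : Type*} [Field K] {N : ℕ} [NeZero N] (hN : 2 ≤ N) (r : ℕ)
    (a : Fin N →₀ ℕ) (k : K) (z : Fin N → ℕ) (hz : ∀ i, z i + z (i+1) ≤ a i) (hr : r ≤ ∑ i, z i) :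
    monomial a k ∈ edgeIdeal K (cycleGraph N) ^ r := by
  have h1 : ∏ i : Fin N, ((X i * X (i+1) : MvPolynomial (Fin N) K)) ^ z (i+1) ∈
      edgeIdeal K (cycleGraph N) ^ r := by
    apply Ideal.pow_le_pow_right hr
    have : ∑ i, z i = ∑ i, z (i+1) := (Equiv.sum_comp (Equiv.addRight (1 : Fin N)) z).symm
    rw [this, ← Finset.prod_pow_eq_pow_sum]
    apply Ideal.prod_mem_prod
    intro i _
    apply Ideal.pow_mem_pow
    exact Ideal.subset_span ⟨i, i+1, cycle_adj hN i, rfl⟩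
  have h2 : ∏ i : Fin N, ((X i * X (i+1) : MvPolynomial (Fin N) K)) ^ z (i+1) =
      ∏ i : Fin N, (X i : MvPolynomial (Fin N) K) ^ (z i + z (i+1)) := by
    simp only [mul_pow, pow_add, Finset.prod_mul_distrib]
    rw [mul_comm]
    congr 1
    exact Equiv.prod_comp (Equiv.addRight (1 : Fin N)) (fun i => (X i : MvPolynomial (Fin N) K) ^ z i)
  rw [h2] at h1
  rw [monomial_eq, Finsupp.prod_fintype _ _ (by simp)]
  apply Ideal.mul_mem_left
  refine Ideal.mem_of_dvd _ ?_ h1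
  exact Finset.prod_dvd_prod_of_dvd _ _ fun i _ => pow_dvd_pow _ (hz i)

open Finset in
lemma rot_card (n : ℕ) :
    (univ.filter (fun d : Fin (2*n+1) => d.val = 0 ∨ d.val % 2 = 1)).card = n + 1 := by
  have : ∑ d : Fin (2*n+1), (if d.val = 0 ∨ d.val % 2 = 1 then 1 else 0) = n + 1 := by
    rw [Fin.sum_univ_eq_sum_range (fun d => if d = 0 ∨ d % 2 = 1 then 1 else 0)]
    induction n with
    | zero => rfl
    | succ n ih =>
      rw [show 2*(n+1)+1 = 2*n+1+1+1 by ring, sum_range_succ, sum_range_succ, ih,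
        if_pos (by omega), if_neg (by omega)]
  rw [card_filter]; exact this

open Finset in
lemma rot_bound (n m : ℕ) (hn : 1 ≤ n) (a : Fin (2*n+1) → ℕ)
    (h : ∀ S : Finset (Fin (2*n+1)), IsVertexCover (cycleGraph (2*n+1)) S → m ≤ ∑ i ∈ S, a i) :
    (2*n+1) * m ≤ (n+1) * ∑ i, a i := by
  let p : Fin (2*n+1) → Prop := fun d => d.val = 0 ∨ d.val % 2 = 1
  have hp : ∀ d, p d ∨ p (d+1) := by
    intro d
    simp only [p]
    have : (d+1).val = (d.val + 1) % (2*n+1) := by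
      rw [Fin.val_add]; simp
    have hd := d.2
    rcases Nat.lt_or_ge (d.val + 1) (2*n+1) with h3 | h3
    · rw [Nat.mod_eq_of_lt h3] at this; omega
    · rw [show d.val + 1 = 2*n+1 by omega, Nat.mod_self] at this; omega
  have hcov : ∀ i, m ≤ ∑ j, if p (j - i) then a j else 0 := by
    intro i
    rw [← sum_filter]
    apply h
    intro j k hjk
    simp only [mem_filter, mem_univ, true_and]
    rcases cycle_adj_iff (by omega) hjk with rfl | rfl
    · rw [show j + 1 - i = (j - i) + 1 by abel]; exact hp _
    · rw [show k + 1 - i = (k - i) + 1 by abel]; exact (hp _).symm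
  calc (2*n+1) * m = ∑ i : Fin (2*n+1), m := by simp
    _ ≤ ∑ i : Fin (2*n+1), ∑ j, if p (j - i) then a j else 0 := sum_le_sum fun i _ => hcov i
    _ = ∑ j, ∑ i : Fin (2*n+1), if p (j - i) then a j else 0 := sum_comm
    _ = ∑ j, (n+1) * a j := by
      apply sum_congr rfl
      intro j _
      refine (Equiv.sum_comp (Equiv.subLeft j) (fun d => if p d then a j else 0)).trans ?_
      rw [← sum_filter, sum_const, rot_card, smul_eq_mul]
    _ = _ := by rw [mul_sum]

open Finset in
lemma sym_le_pow (K : Type*) [Field K] (n m r : ℕ) (hn : 1 ≤ n)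
    (hmr : r * (2*n+2) < m * (2*n+1)) :
    symbolicPower K (cycleGraph (2*n+1)) m ≤ edgeIdeal K (cycleGraph (2*n+1)) ^ r := by
  intro f hf
  rw [f.as_sum]
  apply Ideal.sum_mem
  intro a ha
  have hmin : ∀ S : Finset (Fin (2*n+1)), IsVertexCover (cycleGraph (2*n+1)) S →
      m ≤ ∑ i ∈ S, a i := by
    intro S hS
    obtain ⟨T, hT, hTm⟩ := exists_min_cover _ S hS
    have : f ∈ varIdeal K (2*n+1) T ^ m := by
      simp only [symbolicPower, Ideal.mem_iInf] at hf
      exact hf T hTm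
    exact (varIdeal_pow_support T m f this a ha).trans (sum_le_sum_of_subset hT)
  have hrot := rot_bound n m hn a hmin
  let A : ℕ → ℕ := fun i => if h : i < 2*n+1 then a ⟨i, h⟩ else 0
  have hA : ∀ i : Fin (2*n+1), A i = a i := by intro i; simp only [A]; rw [dif_pos i.2]
  have hAs : ∑ i ∈ range (2*n+1), A i = ∑ i, a i := by
    rw [← Fin.sum_univ_eq_sum_range]; exact sum_congr rfl fun i _ => hA i
  have hsucc : ∀ i : Fin (2*n+1), (i+1).val = (i.val + 1) % (2*n+1) := by
    intro d
    rw [Fin.val_add]; simp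
  have hsucc1 : ∀ i : Fin (2*n+1), i.val < 2*n → (i+1).val = i.val + 1 := by
    intro i hi
    rw [hsucc, Nat.mod_eq_of_lt (by omega)]
  have hsucc2 : ∀ i : Fin (2*n+1), ¬ i.val < 2*n → i.val = 2*n ∧ (i+1).val = 0 := by
    intro i hi
    have := i.2
    have h : i.val = 2*n := by omega
    rw [hsucc, h, Nat.mod_self]; simp
  obtain ⟨z, hz1, hz2, hz3⟩ := cycle_matching A n r hn (by
    intro c hc1 hc2 hc3
    have hS := hmin (univ.filter fun i : Fin (2*n+1) => c i = 1) (by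
      have e : ∀ i : Fin (2*n+1), c i = 1 ∨ c (i+1 : Fin (2*n+1)) = 1 := by
        intro i
        by_cases hi : i.val < 2*n
        · rw [hsucc1 i hi]
          have := hc2 i hi
          have := hc1 i
          have := hc1 (i+1)
          omega
        · obtain ⟨e1, e2⟩ := hsucc2 i hi
          rw [e1, e2]
          have := hc1 0
          have := hc1 (2*n)
          omega
      intro i j hij
      simp only [mem_filter, mem_univ, true_and]
      rcases cycle_adj_iff (by omega) hij with rfl | rfl
      · exact e i
      · exact (e j).symm)
    have : ∑ i ∈ range (2*n+1), c i * A i =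
        ∑ i ∈ (univ.filter fun i : Fin (2*n+1) => c i = 1), a i := by
      rw [← Fin.sum_univ_eq_sum_range (fun i => c i * A i), sum_filter]
      apply sum_congr rfl
      intro i _
      have := hc1 i
      rw [hA]
      split_ifs with h
      · rw [h, one_mul]
      · rw [show c i = 0 by omega, zero_mul]
    rw [this]
    nlinarith) (by
    rw [hAs]
    nlinarith)
  apply monomial_mem_pow (by omega) r a _ (fun i => z i)
  · intro i
    rw [← hA]
    by_cases hi : i.val < 2*n
    · rw [hsucc1 i hi]; exact hz1 _ hi
    · obtain ⟨e1, e2⟩ := hsucc2 i hi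
      rw [e1, e2]; exact hz2
  · rw [Fin.sum_univ_eq_sum_range]; exact hz3

open Finset in
lemma cover_card (n : ℕ) (hn : 1 ≤ n) (S : Finset (Fin (2*n+1)))
    (hS : IsVertexCover (cycleGraph (2*n+1)) S) : n + 1 ≤ S.card := by
  have h1 : ∑ i : Fin (2*n+1), 1 ≤ ∑ i : Fin (2*n+1),
      ((if i ∈ S then 1 else 0) + (if i + 1 ∈ S then 1 else 0)) := by
    apply sum_le_sum
    intro i _
    rcases hS (cycle_adj (by omega) i) with h | h <;> simp [h]
  have h2 : ∑ i : Fin (2*n+1), (if i + 1 ∈ S then 1 else 0) =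
      ∑ i : Fin (2*n+1), (if i ∈ S then 1 else 0) :=
    Equiv.sum_comp (Equiv.addRight (1 : Fin (2*n+1))) (fun i => if i ∈ S then 1 else 0)
  rw [sum_add_distrib, h2] at h1
  simp at h1
  omega

lemma not_sym_le_pow (K : Type*) [Field K] (n k r : ℕ) (hn : 1 ≤ n) (hr : k * (2*n+1) < 2 * r) :
    ¬ symbolicPower K (cycleGraph (2*n+1)) (k * (n+1)) ≤ edgeIdeal K (cycleGraph (2*n+1)) ^ r := by
  classical
  intro hle
  have hmem : (∏ i : Fin (2*n+1), (X i : MvPolynomial (Fin (2*n+1)) K)) ^ k ∈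
      symbolicPower K (cycleGraph (2*n+1)) (k * (n+1)) := by
    simp only [symbolicPower, Ideal.mem_iInf]
    intro S hS
    rw [mul_comm k (n+1), pow_mul]
    apply Ideal.pow_mem_pow
    apply Ideal.pow_le_pow_right (cover_card n hn S hS.1)
    rw [← Finset.prod_mul_prod_compl S]
    apply Ideal.mul_mem_right
    rw [← Finset.prod_const]
    apply Ideal.prod_mem_prod
    intro i hi
    exact Ideal.subset_span ⟨i, by simpa using hi, rfl⟩
  have h2 : edgeIdeal K (cycleGraph (2*n+1)) ≤ varIdeal K (2*n+1) Finset.univ ^ 2 := by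
    rw [edgeIdeal, Ideal.span_le]
    rintro _ ⟨i, j, _, rfl⟩
    rw [pow_two]
    exact Ideal.mul_mem_mul (Ideal.subset_span ⟨i, by simp, rfl⟩)
      (Ideal.subset_span ⟨j, by simp, rfl⟩)
  have h3 := Ideal.pow_right_mono h2 r (hle hmem)
  rw [← pow_mul] at h3
  have e : (∏ i : Fin (2*n+1), (X i : MvPolynomial (Fin (2*n+1)) K)) ^ k =
      monomial (Finsupp.equivFunOnFinite.symm fun _ => k) 1 := by
    rw [monomial_eq, Finsupp.prod_fintype _ _ (by simp)]
    simp [Finset.prod_pow]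
  rw [e] at h3
  have h4 := varIdeal_pow_support _ _ _ h3 (Finsupp.equivFunOnFinite.symm fun _ => k)
    (by simp [mem_support_iff])
  simp at h4
  nlinarith

/-- The resurgence of the edge ideal of the odd cycle `C_{2n+1}` is
`(2n+2)/(2n+1)`: the supremum of the set of ratios `m/r` with `I^(m) ⊄ I^r`
equals `(2n+2)/(2n+1)`. -/
theorem resurgence_cycle (K : Type*) [Field K] (n : ℕ) (hn : 1 ≤ n) :
    sSup {x : ℝ | ∃ m r : ℕ, 1 ≤ m ∧ 1 ≤ r ∧
        ¬ symbolicPower K (cycleGraph (2 * n + 1)) m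
            ≤ edgeIdeal K (cycleGraph (2 * n + 1)) ^ r ∧
        x = (m : ℝ) / (r : ℝ)}
      = (2 * (n : ℝ) + 2) / (2 * (n : ℝ) + 1) := by
  have hpos : (0:ℝ) < 2 * (n:ℝ) + 1 := by positivity
  have hw : ∀ w : ℝ, w < (2 * (n : ℝ) + 2) / (2 * (n : ℝ) + 1) → ∃ x ∈ {x : ℝ | ∃ m r : ℕ, 1 ≤ m ∧ 1 ≤ r ∧
        ¬ symbolicPower K (cycleGraph (2 * n + 1)) m
            ≤ edgeIdeal K (cycleGraph (2 * n + 1)) ^ r ∧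
        x = (m : ℝ) / (r : ℝ)}, w < x := by
    intro w hw
    rw [lt_div_iff₀ hpos] at hw
    obtain ⟨j, hj⟩ := exists_nat_gt (w / ((2 * (n : ℝ) + 2) - w * (2 * (n : ℝ) + 1)))
    rw [div_lt_iff₀ (by linarith)] at hj
    refine ⟨_, ⟨(2*j+1)*(n+1), j*(2*n+1)+n+1, Nat.mul_pos (by omega) (by omega), by omega,
      not_sym_le_pow K n (2*j+1) _ hn (by nlinarith), rfl⟩, ?_⟩
    rw [lt_div_iff₀ (by positivity)]
    push_cast
    have hj0 : (0:ℝ) ≤ j := by positivity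
    nlinarith [mul_nonneg hj0 (by linarith : 0 ≤ (2 * (n : ℝ) + 2) - w * (2 * (n : ℝ) + 1))]
  apply csSup_eq_of_forall_le_of_forall_lt_exists_gt
  · obtain ⟨x, hx, _⟩ := hw ((2 * (n : ℝ) + 2) / (2 * (n : ℝ) + 1) - 1) (by linarith)
    exact ⟨x, hx⟩
  · rintro x ⟨m, r, hm, hr, hnot, rfl⟩
    by_contra hlt
    push Not at hlt
    apply hnot
    apply sym_le_pow K n m r hn
    have hr' : (0:ℝ) < r := by exact_mod_cast hr
    rw [div_lt_div_iff₀ hpos hr'] at hlt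
    have : ((r * (2*n+2) : ℕ) : ℝ) < ((m * (2*n+1) : ℕ) : ℝ) := by
      push_cast; linarith
    exact_mod_cast this
  · exact hw
end
end
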